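/- For every finitely supported function a : ℤ → ℂ, the sum of (1/n2 + 1/(n2+n3))·a(n2)·a(n3)·a(n4) over all triples (n2, n3, n4) of nonzero integers with n2 + n3 + n4 = 0 and n2 + n3 ≠ 0 equals 0. -/

import Mathlib

/-- A finsum of a function that is negated by a permutation of its domain vanishes. -/
theorem finsum_eq_zero_of_comp_equiv_eq_neg {α M : Type*} [AddCommGroup M]
    [IsAddTorsionFree M] {f : α → M} (e : α ≃ α) (h : ∀ x, f (e x) = -f x) :
    ∑ᶠ x, f x = 0 := by
  refine self_eq_neg.1 ?_
  rw [← finsum_neg_distrib, ← finsum_comp_equiv e]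
  exact finsum_congr h

/-- The permutation `(x, y, z) ↦ (z, y, x)` of triples. -/
def swapOuter (α : Type*) : α × α × α ≃ α × α × α where
  toFun t := (t.2.2, t.2.1, t.1)
  invFun t := (t.2.2, t.2.1, t.1)
  left_inv _ := rfl
  right_inv _ := rfl

/-- Vanishing of the α₁·α₃ single-resonance contribution: for any finitely supported
a : ℤ → ℂ, the sum of (1/n₂ + 1/(n₂+n₃))·a(n₂)a(n₃)a(n₄) over nonzero triples with
n₂ + n₃ + n₄ = 0 and n₂ + n₃ ≠ 0 vanishes. -/
theorem alpha1_alpha3_resonance_cancellation (a : ℤ → ℂ)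
    (ha : (Function.support a).Finite) :
    (∑ᶠ t ∈ {t : ℤ × ℤ × ℤ | t.1 ≠ 0 ∧ t.2.1 ≠ 0 ∧ t.2.2 ≠ 0 ∧
        t.1 + t.2.1 + t.2.2 = 0 ∧ t.1 + t.2.1 ≠ 0},
      (1 / (t.1 : ℂ) + 1 / ((t.1 : ℂ) + (t.2.1 : ℂ))) * a t.1 * a t.2.1 * a t.2.2) = 0 := by
  rw [finsum_mem_def]
  refine finsum_eq_zero_of_comp_equiv_eq_neg (swapOuter ℤ) ?_
  rintro ⟨x, y, z⟩
  by_cases h : x ≠ 0 ∧ y ≠ 0 ∧ z ≠ 0 ∧ x + y + z = 0 ∧ x + y ≠ 0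
  · have h' : z ≠ 0 ∧ y ≠ 0 ∧ x ≠ 0 ∧ z + y + x = 0 ∧ z + y ≠ 0 := by lia
    rw [Set.indicator_of_mem (by exact h'), Set.indicator_of_mem (by exact h)]
    have hxy : (x : ℂ) + y = -z := by
      exact_mod_cast (by lia : x + y = -z)
    have hzy : (z : ℂ) + y = -x := by
      exact_mod_cast (by lia : z + y = -x)
    simp only [swapOuter, Equiv.coe_fn_mk, hxy, hzy, one_div, inv_neg]
    ring
  · have h' : ¬(z ≠ 0 ∧ y ≠ 0 ∧ x ≠ 0 ∧ z + y + x = 0 ∧ z + y ≠ 0) := by lia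
    rw [Set.indicator_of_notMem (by exact h'), Set.indicator_of_notMem (by exact h), neg_zero]
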